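/- Let β > 0, let μ : ℝ^d → ℝ^d be twice continuously differentiable with ‖∇μ‖_∞ < ∞, let Σ : ℝ^d → ℝ^{d×d} be twice continuously differentiable with Σ(x) symmetric, Σ(x) ⪰ λ_min I for all x and some λ_min > 0, and ‖∇Σ‖_∞ < ∞, and let ρ be a nonnegative locally integrable weight on ℝ^d that is stationary for (μ,Σ). For V ∈ C_c^∞(ℝ^d), define r := βV − L_{μ,Σ}V. Then ‖∇V‖_ρ ≤ (2/β) ( √(C_{∇μ,∇Σ}/λ_min) ‖r‖_ρ + ‖∇r‖_ρ ), where C_{∇μ,∇Σ} = ‖∇Σ‖_∞²/(2λ_min) + 2‖∇μ‖_∞ + β. -/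

import Mathlib

open MeasureTheory Real
open scoped RealInnerProductSpace

/-- The infinitesimal generator `L_{μ,Σ} f = μ·∇f + ½ Σ : ∇²f`. -/
noncomputable def genOp {d : ℕ} (μ : EuclideanSpace ℝ (Fin d) → EuclideanSpace ℝ (Fin d))
    (Sig : EuclideanSpace ℝ (Fin d) → Fin d → Fin d → ℝ)
    (f : EuclideanSpace ℝ (Fin d) → ℝ) (x : EuclideanSpace ℝ (Fin d)) : ℝ :=
  ⟪μ x, gradient f x⟫ +
    (1 / 2) * ∑ i : Fin d, ∑ j : Fin d, Sig x i j *
      fderiv ℝ (fun y => fderiv ℝ f y (EuclideanSpace.single j 1)) x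
        (EuclideanSpace.single i 1)

/-- The second order part of the generator acting on a product of a function with itself. -/
theorem fderiv_fderiv_sq_apply {E : Type*} [NormedAddCommGroup E] [NormedSpace ℝ E]
    {f : E → ℝ} (hf : ContDiff ℝ 2 f) (x v w : E) :
    fderiv ℝ (fun y => fderiv ℝ (fun z => f z ^ 2) y v) x w =
      2 * f x * fderiv ℝ (fun y => fderiv ℝ f y v) x w +
        2 * (fderiv ℝ f x w * fderiv ℝ f x v) := by
  have hd : Differentiable ℝ f := hf.differentiable (by norm_num)
  have hd' : Differentiable ℝ fun y => fderiv ℝ f y v :=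
    ((hf.fderiv_right (m := 1) (by norm_num)).clm_apply contDiff_const).differentiable
      (by norm_num)
  have h1 : (fun y => fderiv ℝ (fun z => f z ^ 2) y v) =
      fun y => (2 * f y) * fderiv ℝ f y v := by
    funext y
    rw [((hd y).hasFDerivAt.pow 2).fderiv]
    simp
  rw [h1, (((hd x).hasFDerivAt.const_mul 2).fun_mul (hd' x).hasFDerivAt).fderiv]
  simp
  ring

theorem inner_gradient_eq_fderiv {d : ℕ} (f : EuclideanSpace ℝ (Fin d) → ℝ)
    (x v : EuclideanSpace ℝ (Fin d)) : ⟪v, gradient f x⟫ = fderiv ℝ f x v := by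
  rw [real_inner_comm, gradient, InnerProductSpace.toDual_symm_apply]

theorem gradient_apply_eq_fderiv {d : ℕ} (f : EuclideanSpace ℝ (Fin d) → ℝ)
    (x : EuclideanSpace ℝ (Fin d)) (i : Fin d) :
    gradient f x i = fderiv ℝ f x (EuclideanSpace.single i 1) := by
  rw [← inner_gradient_eq_fderiv, EuclideanSpace.inner_single_left]
  simp

/-- The carré du champ identity `L(f²) = 2 f L f + ∇fᵀ Σ ∇f`. -/
theorem genOp_sq {d : ℕ} (μ : EuclideanSpace ℝ (Fin d) → EuclideanSpace ℝ (Fin d))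
    (Sig : EuclideanSpace ℝ (Fin d) → Fin d → Fin d → ℝ)
    {f : EuclideanSpace ℝ (Fin d) → ℝ} (hf : ContDiff ℝ 2 f) (x : EuclideanSpace ℝ (Fin d)) :
    genOp μ Sig (fun y => f y ^ 2) x = 2 * f x * genOp μ Sig f x +
      ∑ i, ∑ j, gradient f x i * Sig x i j * gradient f x j := by
  have hd : Differentiable ℝ f := hf.differentiable (by norm_num)
  simp only [genOp, inner_gradient_eq_fderiv, fderiv_fderiv_sq_apply hf,
    gradient_apply_eq_fderiv]
  rw [((hd x).hasFDerivAt.pow 2).fderiv]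
  simp only [Finset.mul_sum, mul_add, add_assoc]
  rw [← Finset.sum_add_distrib]
  congr 1
  · simp
  refine Finset.sum_congr rfl fun i _ => ?_
  rw [← Finset.sum_add_distrib]
  exact Finset.sum_congr rfl fun j _ => by ring

theorem continuous_gradient {d : ℕ} {f : EuclideanSpace ℝ (Fin d) → ℝ} (hf : ContDiff ℝ 1 f) :
    Continuous (gradient f) :=
  (InnerProductSpace.toDual ℝ _).symm.continuous.comp (hf.continuous_fderiv (by norm_num))

theorem continuous_genOp {d : ℕ} {μ : EuclideanSpace ℝ (Fin d) → EuclideanSpace ℝ (Fin d)}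
    {Sig : EuclideanSpace ℝ (Fin d) → Fin d → Fin d → ℝ} (hμ : Continuous μ)
    (hSig : ∀ i j, Continuous fun x => Sig x i j)
    {f : EuclideanSpace ℝ (Fin d) → ℝ} (hf : ContDiff ℝ 2 f) : Continuous (genOp μ Sig f) := by
  refine (hμ.inner (continuous_gradient (hf.of_le (by norm_num)))).add
    (continuous_const.mul (continuous_finsetSum _ fun i _ => continuous_finsetSum _ fun j _ =>
      (hSig i j).mul ?_))
  have h1 : ContDiff ℝ 1 fun y => fderiv ℝ f y (EuclideanSpace.single j 1) :=
    (hf.fderiv_right (by norm_num)).clm_apply contDiff_const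
  exact (h1.continuous_fderiv (by norm_num)).clm_apply continuous_const

theorem HasCompactSupport.genOp {d : ℕ}
    (μ : EuclideanSpace ℝ (Fin d) → EuclideanSpace ℝ (Fin d))
    (Sig : EuclideanSpace ℝ (Fin d) → Fin d → Fin d → ℝ)
    {f : EuclideanSpace ℝ (Fin d) → ℝ} (hf : HasCompactSupport f) :
    HasCompactSupport (genOp μ Sig f) := by
  refine HasCompactSupport.intro hf fun x hx => ?_
  have h0 : f =ᶠ[nhds x] fun _ => 0 := notMem_tsupport_iff_eventuallyEq.mp hx
  have h1 : ∀ v, (fun y => fderiv ℝ f y v) =ᶠ[nhds x] fun _ => 0 := fun v => by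
    filter_upwards [h0.fderiv (𝕜 := ℝ)] with y hy
    simp [hy]
  simp only [_root_.genOp, inner_gradient_eq_fderiv, (h1 _).fderiv_eq, h0.fderiv_eq]
  simp

theorem HasCompactSupport.gradient {d : ℕ} {f : EuclideanSpace ℝ (Fin d) → ℝ}
    (hf : HasCompactSupport f) : HasCompactSupport (gradient f) :=
  (hf.fderiv (𝕜 := ℝ)).comp_left (map_zero _)

/-- The energy estimate `λ ‖∇V‖²_ρ ≤ ‖βV - LV‖²_ρ / (2β)`, obtained by testing stationarity of
`ρ` against `V²`. -/
theorem energy_estimate {d : ℕ} {β lammin : ℝ} (hβ : 0 < β)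
    {μ : EuclideanSpace ℝ (Fin d) → EuclideanSpace ℝ (Fin d)} (hμ : Continuous μ)
    {Sig : EuclideanSpace ℝ (Fin d) → Fin d → Fin d → ℝ}
    (hSig : ∀ i j, Continuous fun x => Sig x i j)
    (hSigPos : ∀ x (v : Fin d → ℝ),
      lammin * ∑ i, v i ^ 2 ≤ ∑ i, ∑ j, v i * Sig x i j * v j)
    {ρ : EuclideanSpace ℝ (Fin d) → ℝ} (hρ : ∀ x, 0 ≤ ρ x) (hρloc : LocallyIntegrable ρ)
    {V : EuclideanSpace ℝ (Fin d) → ℝ} (hV : ContDiff ℝ 2 V) (hVsupp : HasCompactSupport V)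
    (hstat : ∫ x, genOp μ Sig (fun y => V y ^ 2) x * ρ x = 0) :
    lammin * ∫ x, ‖gradient V x‖ ^ 2 * ρ x ≤
      (∫ x, (β * V x - genOp μ Sig V x) ^ 2 * ρ x) / (2 * β) := by
  have key : ∀ {g : EuclideanSpace ℝ (Fin d) → ℝ}, Continuous g → HasCompactSupport g →
      Integrable fun x => g x * ρ x := fun hg hgs =>
    hρloc.integrable_smul_left_of_hasCompactSupport hg hgs
  have hVsq : HasCompactSupport fun y => V y ^ 2 :=
    hVsupp.comp_left (g := fun t : ℝ => t ^ 2) (by simp)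
  have hgrad : Integrable fun x => ‖gradient V x‖ ^ 2 * ρ x :=
    key ((continuous_gradient (hV.of_le (by norm_num))).norm.pow 2)
      (hVsupp.gradient.comp_left (g := fun v => ‖v‖ ^ 2) (by simp))
  have hgen : Integrable fun x => genOp μ Sig (fun y => V y ^ 2) x * ρ x :=
    key (continuous_genOp hμ hSig (hV.pow 2)) (hVsq.genOp μ Sig)
  have hr : Integrable fun x => (β * V x - genOp μ Sig V x) ^ 2 * ρ x := by
    refine key (((continuous_const.mul hV.continuous).sub
      (continuous_genOp hμ hSig hV)).pow 2) ?_
    exact HasCompactSupport.comp₂_left (m := fun a b : ℝ => (β * a - b) ^ 2) hVsupp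
      (hVsupp.genOp μ Sig) (by simp)
  rw [← integral_const_mul, ← integral_div]
  calc ∫ x, lammin * (‖gradient V x‖ ^ 2 * ρ x)
      ≤ ∫ x, (genOp μ Sig (fun y => V y ^ 2) x * ρ x +
          (β * V x - genOp μ Sig V x) ^ 2 * ρ x / (2 * β)) := by
        refine integral_mono (hgrad.const_mul _) (hgen.add (hr.div_const _)) fun x => ?_
        have h1 := hSigPos x (gradient V x).ofLp
        rw [← EuclideanSpace.real_norm_sq_eq] at h1
        have h2 := genOp_sq μ Sig hV x
        set r := β * V x - genOp μ Sig V x with hrdef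
        have h3 : 2 * r * V x - 2 * β * V x ^ 2 ≤ r ^ 2 / (2 * β) := by
          rw [le_div_iff₀ (by positivity)]
          nlinarith [sq_nonneg (r - 2 * β * V x)]
        have h4 : lammin * ‖gradient V x‖ ^ 2 ≤
            genOp μ Sig (fun y => V y ^ 2) x + r ^ 2 / (2 * β) := by
          rw [h2]
          have : genOp μ Sig V x = β * V x - r := by rw [hrdef]; ring
          rw [this]
          linarith
        calc lammin * (‖gradient V x‖ ^ 2 * ρ x) = lammin * ‖gradient V x‖ ^ 2 * ρ x := by ring
          _ ≤ _ := mul_le_mul_of_nonneg_right h4 (hρ x)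
          _ = _ := by ring
    _ = _ := by rw [integral_add hgen (hr.div_const _), hstat, zero_add]

/-- Weighted `L²` a priori bound for the gradient of the solution of
`βV − L_{μ,Σ}V = r` (first inequality of Lemma `lemma:pt_s l2 est`). -/
theorem gradient_value_function_estimate {d : ℕ} (β lammin Dmu DSig : ℝ)
    (hβ : 0 < β) (hlammin : 0 < lammin)
    (μ : EuclideanSpace ℝ (Fin d) → EuclideanSpace ℝ (Fin d)) (hμ : ContDiff ℝ 2 μ)
    (hDmu : ∀ x, ‖fderiv ℝ μ x‖ ≤ Dmu)
    (Sig : EuclideanSpace ℝ (Fin d) → Fin d → Fin d → ℝ)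
    (hSigC2 : ∀ i j, ContDiff ℝ 2 fun x => Sig x i j)
    (hSigSymm : ∀ x i j, Sig x i j = Sig x j i)
    (hSigPos : ∀ x (v : Fin d → ℝ),
      lammin * ∑ i, v i ^ 2 ≤ ∑ i, ∑ j, v i * Sig x i j * v j)
    (hDSig : ∀ x, ‖fderiv ℝ Sig x‖ ≤ DSig)
    (ρ : EuclideanSpace ℝ (Fin d) → ℝ) (hρ : ∀ x, 0 ≤ ρ x)
    (hρloc : LocallyIntegrable ρ)
    (hstat : ∀ φ : EuclideanSpace ℝ (Fin d) → ℝ, ContDiff ℝ (⊤ : ℕ∞) φ → HasCompactSupport φ →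
      ∫ x, genOp μ Sig φ x * ρ x = 0)
    (V : EuclideanSpace ℝ (Fin d) → ℝ) (hV : ContDiff ℝ (⊤ : ℕ∞) V)
    (hVsupp : HasCompactSupport V) :
    Real.sqrt (∫ x, ‖gradient V x‖ ^ 2 * ρ x) ≤
      (2 / β) *
        (Real.sqrt ((DSig ^ 2 / (2 * lammin) + 2 * Dmu + β) / lammin) *
            Real.sqrt (∫ x, (β * V x - genOp μ Sig V x) ^ 2 * ρ x) +
          Real.sqrt (∫ x,
            ‖gradient (fun y => β * V y - genOp μ Sig V y) x‖ ^ 2 * ρ x)) := by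
  have hV2 : ContDiff ℝ 2 V := hV.of_le (WithTop.coe_le_coe.mpr le_top)
  have hen := energy_estimate hβ hμ.continuous (fun i j => (hSigC2 i j).continuous) hSigPos hρ
    hρloc hV2 hVsupp (hstat _ (hV.pow 2) (hVsupp.comp_left (g := fun t : ℝ => t ^ 2) (by simp)))
  have hDmu0 : 0 ≤ Dmu := (norm_nonneg _).trans (hDmu 0)
  set R := ∫ x, (β * V x - genOp μ Sig V x) ^ 2 * ρ x
  have hR : 0 ≤ R := integral_nonneg fun x => mul_nonneg (sq_nonneg _) (hρ x)
  have hC : β / lammin ≤ (DSig ^ 2 / (2 * lammin) + 2 * Dmu + β) / lammin := by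
    gcongr
    have : 0 ≤ DSig ^ 2 / (2 * lammin) := by positivity
    linarith
  have hmain : Real.sqrt (∫ x, ‖gradient V x‖ ^ 2 * ρ x) ≤
      (2 / β) * (Real.sqrt (β / lammin) * Real.sqrt R) := by
    rw [Real.sqrt_le_left (by positivity), mul_pow, mul_pow, Real.sq_sqrt (by positivity),
      Real.sq_sqrt hR]
    have h1 : (∫ x, ‖gradient V x‖ ^ 2 * ρ x) ≤ R / (2 * β) / lammin := by
      rw [le_div_iff₀ hlammin]
      linarith
    refine h1.trans ?_
    have h2 : (2 / β) ^ 2 * (β / lammin * R) = 8 * (R / (2 * β) / lammin) := by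
      field_simp
      ring
    have h3 : 0 ≤ R / (2 * β) / lammin := by positivity
    linarith
  refine hmain.trans ?_
  refine mul_le_mul_of_nonneg_left ?_ (by positivity)
  exact (mul_le_mul_of_nonneg_right (Real.sqrt_le_sqrt hC) (Real.sqrt_nonneg _)).trans
    (le_add_of_nonneg_right (Real.sqrt_nonneg _))
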